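/- Consider the lattice ℤ² with its combinatorial Laplacian L on ℓ²(ℤ²), and let S = ℤ² ∖ {(2k₁, 2k₂) : k₁, k₂ ∈ ℤ} be the complement of the even sublattice. If 0 < ω < 1, then: (1) S is a uniqueness set for PW_ω(L), i.e., if f, g ∈ PW_ω(L) satisfy f(u) = g(u) for all u ∈ S then f = g; and (2) there exist functions Θ_u ∈ PW_ω(L), u ∈ S, such that every f ∈ PW_ω(L) satisfies f = Σ_{u∈S} f(u)·Θ_u, the series converging unconditionally in ℓ²(ℤ²). -/

import Mathlib

open scoped BigOperators ENNReal

/-- The Paley–Wiener space `PW_ω(L)` in `ℓ²(ℤ²)`: all `f` satisfying the Bernstein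
inequality `‖L^k f‖ ≤ ω^k ‖f‖` for all `k ∈ ℕ`. -/
def PW (L : lp (fun _ : ℤ × ℤ => ℂ) 2 →L[ℂ] lp (fun _ : ℤ × ℤ => ℂ) 2) (ω : ℝ) :
    Set (lp (fun _ : ℤ × ℤ => ℂ) 2) :=
  {f | ∀ k : ℕ, ‖(L ^ k) f‖ ≤ ω ^ k * ‖f‖}

/-- The complement of the even sublattice `{(2k₁, 2k₂)}` in `ℤ²`. -/
def S : Set (ℤ × ℤ) := {p | ¬ (Even p.1 ∧ Even p.2)}

section Bernstein

variable {H : Type*} [NormedAddCommGroup H] [InnerProductSpace ℂ H] [CompleteSpace H]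

theorem IsSelfAdjoint.norm_pow_apply_sq_le {T : H →L[ℂ] H} (hT : IsSelfAdjoint T) (k : ℕ) (f : H) :
    ‖(T ^ k) f‖ ^ 2 ≤ ‖f‖ * ‖(T ^ (2 * k)) f‖ := by
  have hinner : inner ℂ ((T ^ k) f) ((T ^ k) f) = inner ℂ f ((T ^ (2 * k)) f) := by
    rw [two_mul, pow_add, mul_apply_eq_comp]
    exact (hT.pow k).isSymmetric f ((T ^ k) f)
  have hnorm : ‖(T ^ k) f‖ ^ 2 = ‖inner ℂ ((T ^ k) f) ((T ^ k) f)‖ := by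
    simp [inner_self_eq_norm_sq_to_K]
  rw [hnorm, hinner]
  exact norm_inner_le_norm _ _

/-- For a self-adjoint operator, the growth bound `O(ω ^ k)` on `‖T ^ k f‖` self-improves to the
Bernstein inequality with constant `‖f‖`. -/
theorem IsSelfAdjoint.bernstein_of_bound {T : H →L[ℂ] H} (hT : IsSelfAdjoint T) {ω C : ℝ}
    (hω : 0 < ω) {f : H} (hC : ∀ k : ℕ, ‖(T ^ k) f‖ ≤ ω ^ k * C) (k : ℕ) :
    ‖(T ^ k) f‖ ≤ ω ^ k * ‖f‖ := by
  set b : ℕ → ℝ := fun k => ‖(T ^ k) f‖ / ω ^ k with hb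
  have hbdd : BddAbove (Set.range b) := by
    refine ⟨C, ?_⟩
    rintro _ ⟨k, rfl⟩
    exact (div_le_iff₀' (pow_pos hω k)).2 (hC k)
  have hle : ∀ k, b k ≤ ⨆ j, b j := le_ciSup hbdd
  have hb0 : b 0 = ‖f‖ := by simp [hb]
  have hsup0 : 0 ≤ ⨆ j, b j := (norm_nonneg f).trans (hb0 ▸ hle 0)
  have hsq : ∀ k, b k ^ 2 ≤ ‖f‖ * ⨆ j, b j := fun k =>
    calc b k ^ 2 = ‖(T ^ k) f‖ ^ 2 / ω ^ (2 * k) := by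
          rw [hb, div_pow, ← pow_mul, mul_comm k 2]
      _ ≤ ‖f‖ * ‖(T ^ (2 * k)) f‖ / ω ^ (2 * k) := by
          gcongr
          exact hT.norm_pow_apply_sq_le k f
      _ = ‖f‖ * b (2 * k) := mul_div_assoc _ _ _
      _ ≤ ‖f‖ * ⨆ j, b j := by
          gcongr
          exact hle _
  have hsup : ⨆ j, b j ≤ ‖f‖ := by
    have hsqrt : ⨆ j, b j ≤ √(‖f‖ * ⨆ j, b j) := ciSup_le fun k => Real.le_sqrt_of_sq_le (hsq k)
    have hmul := (Real.le_sqrt hsup0 (by positivity)).1 hsqrt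
    rcases hsup0.eq_or_lt with h | h
    · exact h ▸ norm_nonneg f
    · nlinarith
  exact (div_le_iff₀' (pow_pos hω k)).1 ((hle k).trans hsup)

/-- The vectors satisfying the Bernstein inequality for a self-adjoint operator. -/
def bernsteinSubmodule (T : H →L[ℂ] H) (hT : IsSelfAdjoint T) {ω : ℝ} (hω : 0 < ω) :
    Submodule ℂ H where
  carrier := {f | ∀ k : ℕ, ‖(T ^ k) f‖ ≤ ω ^ k * ‖f‖}
  zero_mem' k := by simp
  add_mem' {f g} hf hg := hT.bernstein_of_bound hω (C := ‖f‖ + ‖g‖) fun k => by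
    rw [map_add, mul_add]
    exact (norm_add_le _ _).trans (add_le_add (hf k) (hg k))
  smul_mem' c f hf k := by
    rw [map_smul, norm_smul, norm_smul, mul_left_comm]
    exact mul_le_mul_of_nonneg_left (hf k) (norm_nonneg c)

theorem isClosed_bernsteinSubmodule (T : H →L[ℂ] H) (hT : IsSelfAdjoint T) {ω : ℝ} (hω : 0 < ω) :
    IsClosed (bernsteinSubmodule T hT hω : Set H) := by
  change IsClosed {f : H | ∀ k : ℕ, ‖(T ^ k) f‖ ≤ ω ^ k * ‖f‖}
  simp only [Set.ofPred_forall]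
  exact isClosed_iInter fun k => isClosed_le (by fun_prop) (by fun_prop)

/-- A bounded-below continuous linear map between Hilbert spaces has a continuous left inverse. -/
theorem ContinuousLinearMap.hasLeftInverse_of_norm_le {E : Type*} [NormedAddCommGroup E]
    [NormedSpace ℂ E] [CompleteSpace E] (R : E →L[ℂ] H) {C : ℝ} (hC : ∀ x, ‖x‖ ≤ C * ‖R x‖) :
    R.HasLeftInverse := by
  have hanti : AntilipschitzWith C.toNNReal R := R.antilipschitz_of_bound fun x =>
    (hC x).trans (mul_le_mul_of_nonneg_right (Real.le_coe_toNNReal C) (norm_nonneg _))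
  have hclosed : IsClosed (Set.range R) := hanti.isClosed_range R.uniformContinuous
  have : CompleteSpace R.range := hclosed.completeSpace_coe
  exact .of_injective_of_isClosed_range_of_closedComplement_range hanti.injective hclosed
    ⟨R.range.orthogonalProjectionOnto,
      fun x => Submodule.orthogonalProjectionOnto_mem_subspace_eq_self x⟩

end Bernstein

section Restriction

variable {ι : Type*}

open Classical in
/-- Multiplication by the indicator function of `A` on `ℓ²`. -/
noncomputable def lpRestrict (A : Set ι) :
    lp (fun _ : ι => ℂ) 2 →L[ℂ] lp (fun _ : ι => ℂ) 2 :=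
  lp.mapCLM 2 (fun i => if i ∈ A then ContinuousLinearMap.id ℂ ℂ else 0) zero_le_one
    (fun i => by split_ifs <;> simp)

theorem lpRestrict_of_mem {A : Set ι} {i : ι} (hi : i ∈ A) (f : lp (fun _ : ι => ℂ) 2) :
    lpRestrict A f i = f i := by
  simp [lpRestrict, hi]

theorem lpRestrict_of_notMem {A : Set ι} {i : ι} (hi : i ∉ A) (f : lp (fun _ : ι => ℂ) 2) :
    lpRestrict A f i = 0 := by
  simp [lpRestrict, hi]

theorem norm_lpRestrict_apply_le (A : Set ι) (f : lp (fun _ : ι => ℂ) 2) :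
    ‖lpRestrict A f‖ ≤ ‖f‖ := by
  simpa using (lpRestrict A).le_of_opNorm_le (lp.norm_mapCLM_le 2 _ zero_le_one _) f

theorem lpRestrict_add_compl (A : Set ι) (f : lp (fun _ : ι => ℂ) 2) :
    lpRestrict A f + lpRestrict Aᶜ f = f := by
  ext i
  by_cases hi : i ∈ A
  · simp [lpRestrict_of_mem hi, lpRestrict_of_notMem (Set.notMem_compl_iff.2 hi)]
  · simp [lpRestrict_of_notMem hi, lpRestrict_of_mem (Set.mem_compl hi)]

theorem hasSum_lpRestrict [DecidableEq ι] (A : Set ι) (f : lp (fun _ : ι => ℂ) 2) :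
    HasSum (fun u : A => f u • lp.single (E := fun _ : ι => ℂ) 2 (u : ι) 1)
      (lpRestrict A f) := by
  have h := lp.hasSum_single ENNReal.ofNat_ne_top (lpRestrict A f)
  rw [← hasSum_subtype_iff_of_support_subset (s := A)] at h
  · refine h.congr_fun fun u => ?_
    rw [Function.comp_apply, lpRestrict_of_mem u.2, ← lp.single_smul, smul_eq_mul, mul_one]
  · intro i hi
    by_contra hiA
    simp [lpRestrict_of_notMem hiA] at hi

end Restriction

section Laplacian

theorem isSelfAdjoint_latticeLaplacian
    (L : lp (fun _ : ℤ × ℤ => ℂ) 2 →L[ℂ] lp (fun _ : ℤ × ℤ => ℂ) 2)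
    (hL : ∀ (f : lp (fun _ : ℤ × ℤ => ℂ) 2) (p : ℤ × ℤ),
      (L f : ∀ _ : ℤ × ℤ, ℂ) p =
        4 * f p - f (p.1 + 1, p.2) - f (p.1 - 1, p.2) - f (p.1, p.2 + 1) - f (p.1, p.2 - 1)) :
    IsSelfAdjoint L := by
  rw [ContinuousLinearMap.isSelfAdjoint_iff']
  refine lp.ext_continuousLinearMap ENNReal.ofNat_ne_top fun p => ?_
  ext q
  have hadj : (L.adjoint (lp.single 2 p 1)) q = starRingEnd ℂ (L (lp.single 2 q 1) p) := by
    have h := L.adjoint_inner_right (lp.single 2 q 1) (lp.single 2 p 1)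
    rw [lp.inner_single_left, lp.inner_single_right] at h
    simpa using h
  obtain ⟨p₁, p₂⟩ := p
  obtain ⟨q₁, q₂⟩ := q
  simp only [ContinuousLinearMap.comp_apply, lp.singleContinuousLinearMap_apply, hadj, hL,
    lp.coeFn_single, Pi.single_apply, Prod.mk.injEq, map_sub, map_mul,
    apply_ite (starRingEnd ℂ), map_one, map_zero, map_ofNat]
  have h₀ : (p₁ = q₁ ∧ p₂ = q₂) ↔ (q₁ = p₁ ∧ q₂ = p₂) := by lia
  have h₁ : (p₁ + 1 = q₁ ∧ p₂ = q₂) ↔ (q₁ - 1 = p₁ ∧ q₂ = p₂) := by lia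
  have h₂ : (p₁ - 1 = q₁ ∧ p₂ = q₂) ↔ (q₁ + 1 = p₁ ∧ q₂ = p₂) := by lia
  have h₃ : (p₁ = q₁ ∧ p₂ + 1 = q₂) ↔ (q₁ = p₁ ∧ q₂ - 1 = p₂) := by lia
  have h₄ : (p₁ = q₁ ∧ p₂ - 1 = q₂) ↔ (q₁ = p₁ ∧ q₂ + 1 = p₂) := by lia
  simp only [h₀, h₁, h₂, h₃, h₄]
  ring

theorem norm_le_of_norm_latticeLaplacian_le
    (L : lp (fun _ : ℤ × ℤ => ℂ) 2 →L[ℂ] lp (fun _ : ℤ × ℤ => ℂ) 2)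
    (hL : ∀ (f : lp (fun _ : ℤ × ℤ => ℂ) 2) (p : ℤ × ℤ),
      (L f : ∀ _ : ℤ × ℤ, ℂ) p =
        4 * f p - f (p.1 + 1, p.2) - f (p.1 - 1, p.2) - f (p.1, p.2 + 1) - f (p.1, p.2 - 1))
    {ω : ℝ} (hω : ω < 4) {f : lp (fun _ : ℤ × ℤ => ℂ) 2} (hf : ‖L f‖ ≤ ω * ‖f‖) :
    ‖f‖ ≤ (4 + ‖L‖) / (4 - ω) * ‖lpRestrict S f‖ := by
  have hid : (4 : ℂ) • lpRestrict Sᶜ f =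
      lpRestrict Sᶜ (L f) - lpRestrict Sᶜ (L (lpRestrict S f)) := by
    ext p
    by_cases hp : p ∈ S
    · simp [lpRestrict_of_notMem (Set.notMem_compl_iff.2 hp)]
    · have heven : Even p.1 ∧ Even p.2 := not_not.1 hp
      have h₁ : (p.1 + 1, p.2) ∈ S := fun h => by have := h.1; have := heven.1; grind
      have h₂ : (p.1 - 1, p.2) ∈ S := fun h => by have := h.1; have := heven.1; grind
      have h₃ : (p.1, p.2 + 1) ∈ S := fun h => by have := h.2; have := heven.2; grind
      have h₄ : (p.1, p.2 - 1) ∈ S := fun h => by have := h.2; have := heven.2; grind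
      simp only [lp.coeFn_smul, lp.coeFn_sub, Pi.smul_apply, Pi.sub_apply, smul_eq_mul,
        lpRestrict_of_mem (Set.mem_compl hp), hL, lpRestrict_of_notMem hp, lpRestrict_of_mem h₁,
        lpRestrict_of_mem h₂, lpRestrict_of_mem h₃, lpRestrict_of_mem h₄]
      ring
  have hcompl : 4 * ‖lpRestrict Sᶜ f‖ ≤ ω * ‖f‖ + ‖L‖ * ‖lpRestrict S f‖ :=
    calc 4 * ‖lpRestrict Sᶜ f‖ = ‖(4 : ℂ) • lpRestrict Sᶜ f‖ := by rw [norm_smul]; norm_num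
      _ ≤ ‖lpRestrict Sᶜ (L f)‖ + ‖lpRestrict Sᶜ (L (lpRestrict S f))‖ := by
          rw [hid]
          exact norm_sub_le _ _
      _ ≤ ω * ‖f‖ + ‖L‖ * ‖lpRestrict S f‖ :=
          add_le_add ((norm_lpRestrict_apply_le _ _).trans hf)
            ((norm_lpRestrict_apply_le _ _).trans (L.le_opNorm _))
  have hsum : ‖f‖ ≤ ‖lpRestrict S f‖ + ‖lpRestrict Sᶜ f‖ := by
    simpa only [lpRestrict_add_compl] using norm_add_le (lpRestrict S f) (lpRestrict Sᶜ f)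
  rw [div_mul_eq_mul_div, le_div_iff₀ (by linarith)]
  linarith

end Laplacian

theorem stmt19
    (L : lp (fun _ : ℤ × ℤ => ℂ) 2 →L[ℂ] lp (fun _ : ℤ × ℤ => ℂ) 2)
    (hL : ∀ (f : lp (fun _ : ℤ × ℤ => ℂ) 2) (p : ℤ × ℤ),
      (L f : ∀ _ : ℤ × ℤ, ℂ) p =
        4 * f p - f (p.1 + 1, p.2) - f (p.1 - 1, p.2) - f (p.1, p.2 + 1) - f (p.1, p.2 - 1))
    (ω : ℝ) (hω0 : 0 < ω) (hω1 : ω < 1) :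
    (∀ f ∈ PW L ω, ∀ g ∈ PW L ω, (∀ u ∈ S, f u = g u) → f = g) ∧
    (∃ Θ : S → lp (fun _ : ℤ × ℤ => ℂ) 2,
      (∀ u : S, Θ u ∈ PW L ω) ∧
      ∀ f ∈ PW L ω, HasSum (fun u : S => f (u : ℤ × ℤ) • Θ u) f) := by
  have hsa := isSelfAdjoint_latticeLaplacian L hL
  set V := bernsteinSubmodule L hsa hω0
  have hV : CompleteSpace V := (isClosed_bernsteinSubmodule L hsa hω0).completeSpace_coe
  have hbelow (x : V) :
      ‖x‖ ≤ (4 + ‖L‖) / (4 - ω) * ‖((lpRestrict S).comp V.subtypeL) x‖ :=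
    norm_le_of_norm_latticeLaplacian_le L hL (by linarith) (by simpa using x.2 1)
  obtain ⟨A, hA⟩ := ContinuousLinearMap.hasLeftInverse_of_norm_le _ hbelow
  have hexp : ∀ f ∈ PW L ω, HasSum
      (fun u : S => f (u : ℤ × ℤ) • (A (lp.single 2 (u : ℤ × ℤ) 1) : lp (fun _ : ℤ × ℤ => ℂ) 2))
      f := fun f hf => by
    have h := (hasSum_lpRestrict S f).mapL (V.subtypeL.comp A)
    have hAf : A (lpRestrict S f) = ⟨f, hf⟩ := hA ⟨f, hf⟩
    simpa [hAf] using h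
  refine ⟨fun f hf g hg hfg => (hexp f hf).unique ?_,
    fun u => A (lp.single 2 (u : ℤ × ℤ) 1), fun u => (A _).2, hexp⟩
  simpa only [hfg _ (Subtype.prop _)] using hexp g hg
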